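/- Let p be a prime, q = p^n, and let ℓ be an odd prime and r ≥ 1 an integer such that GL_2(F_q) contains an element of order ℓ^r. Then K_{ℓ^r}(GL_2(F_q)) = ℚ(ζ_{ℓ^r}) if q ≡ 1 (mod ℓ^r); K_{ℓ^r}(GL_2(F_q)) = ℚ(ζ_{ℓ^r} + ζ_{ℓ^r}^{−1}) if q ≡ −1 (mod ℓ^r); and K_{ℓ^r}(GL_2(F_q)) = ℚ if q ≡ 0 (mod ℓ^r). -/

import Mathlib

open CategoryTheory

/-- `zeta N` is the root of unity `e^{2 π i / N}`. -/
noncomputable def zeta (N : ℕ) : ℂ := Complex.exp (2 * Real.pi * Complex.I / N)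

/-- `charField G` is the field `K(G)` generated over `ℚ` by all values of
irreducible complex characters of `G`. -/
noncomputable def charField (G : Type) [Group G] : IntermediateField ℚ ℂ :=
  IntermediateField.adjoin ℚ
    {x : ℂ | ∃ V : FDRep ℂ G, Simple V ∧ ∃ g : G, V.character g = x}

/-- `charFieldAt G d` is the field `K_d(G)` generated over `ℚ` by the values of
irreducible complex characters of `G` at elements of order exactly `d`. -/
noncomputable def charFieldAt (G : Type) [Group G] (d : ℕ) : IntermediateField ℚ ℂ :=
  IntermediateField.adjoin ℚ
    {x : ℂ | ∃ V : FDRep ℂ G, Simple V ∧ ∃ g : G, orderOf g = d ∧ V.character g = x}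

section Traces

/-- If `T ^ d = 1`, the trace of a polynomial in `T` lies in any field containing the values of the
polynomial at all `d`-th roots of unity. -/
lemma trace_aeval_mem {V : Type*} [AddCommGroup V] [Module ℂ V] [FiniteDimensional ℂ V]
    {T : Module.End ℂ V} {d : ℕ} (hT : T ^ d = 1) {K : IntermediateField ℚ ℂ}
    {f : Polynomial ℂ} (hf : ∀ z : ℂ, z ^ d = 1 → f.eval z ∈ K) :
    LinearMap.trace ℂ V (Polynomial.aeval T f) ∈ K := by
  rw [Module.End.trace_eq_sum_roots_charpoly_of_splits (IsAlgClosed.splits _)]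
  refine multiset_sum_mem _ fun μ hμ ↦ ?_
  have hμ' :=
    (Module.End.mem_spectrum_iff_isRoot_charpoly _ μ).2 (Polynomial.isRoot_of_mem_roots hμ)
  have hnt : Nontrivial V := by
    by_contra h
    rw [not_nontrivial_iff_subsingleton] at h
    obtain ⟨v, -, hv⟩ :=
      (Module.End.hasEigenvalue_iff_mem_spectrum.2 hμ').exists_hasEigenvector
    exact hv (Subsingleton.elim _ _)
  rw [spectrum.map_polynomial_aeval_of_nonempty _ _
    (spectrum.nonempty_of_isAlgClosed_of_finiteDimensional ℂ T)] at hμ'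
  obtain ⟨z, hz, rfl⟩ := hμ'
  refine hf z ?_
  obtain ⟨v, hv⟩ := (Module.End.hasEigenvalue_iff_mem_spectrum.2 hz).exists_hasEigenvector
  have h := hv.pow_apply d
  rw [hT, Module.End.one_apply] at h
  have h0 : (z ^ d - 1) • v = 0 := by rw [sub_smul, ← h, one_smul, sub_self]
  exact sub_eq_zero.1 ((smul_eq_zero.1 h0).resolve_right hv.2)

lemma trace_eq_add_of_isCompl {V : Type*} [AddCommGroup V] [Module ℂ V] [FiniteDimensional ℂ V]
    {p q : Submodule ℂ V} (h : IsCompl p q) {f : V →ₗ[ℂ] V}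
    (hp : Set.MapsTo f p p) (hq : Set.MapsTo f q q) :
    LinearMap.trace ℂ V f =
      LinearMap.trace ℂ p (f.restrict hp) + LinearMap.trace ℂ q (f.restrict hq) := by
  have hI : DirectSum.IsInternal (fun b : Bool ↦ (cond b p q : Submodule ℂ V)) :=
    (DirectSum.isInternal_submodule_iff_isCompl _ (i := true) (j := false) (by simp)
      (by ext b; cases b <;> simp)).2 h
  have := LinearMap.trace_eq_sum_trace_restrict hI (f := f)
    (by rintro (_ | _); exacts [hq, hp])
  rw [this, Fintype.sum_bool]
  rfl

lemma trace_pi_eq_sum {ι : Type*} [Fintype ι] [DecidableEq ι] (f : (ι → ℂ) →ₗ[ℂ] ι → ℂ) :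
    LinearMap.trace ℂ (ι → ℂ) f = ∑ i, f (Pi.single i 1) i := by
  rw [LinearMap.trace_eq_matrix_trace ℂ (Pi.basisFun ℂ ι), Matrix.trace]
  simp

end Traces

section CharacterFields

variable {G : Type} [Group G]

/-- The field `charFieldAt G d` contains the values at elements of order `d` of the characters of
all representations, not only of the irreducible ones. -/
lemma character_mem_charFieldAt [Finite G] {d : ℕ} {g : G} (hg : orderOf g = d) (V : Type)
    [AddCommGroup V] [Module ℂ V] [FiniteDimensional ℂ V] (ρ : Representation ℂ G V) :
    ρ.character g ∈ charFieldAt G d := by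
  induction hn : Module.finrank ℂ V using Nat.strong_induction_on generalizing V with
  | _ n ih =>
  cases nonempty_fintype G
  have hcard : (Nat.card G : ℂ) ≠ 0 := Nat.cast_ne_zero.2 Nat.card_pos.ne'
  let _ := invertibleOfNonzero hcard
  have : NeZero (Nat.card G : ℂ) := ⟨hcard⟩
  by_cases hirr : ρ.IsIrreducible
  · refine IntermediateField.subset_adjoin _ _ ⟨FDRep.of ρ, ?_, g, hg, rfl⟩
    rw [FDRep.simple_iff_char_is_norm_one]
    have h := Representation.char_orthonormal ρ ρ
    rw [if_pos ⟨Representation.Equiv.refl ρ⟩, inv_mul_eq_one₀ hcard] at h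
    exact h.symm
  obtain hV | hV := subsingleton_or_nontrivial V
  · rw [Representation.character, Subsingleton.elim (ρ g) 0, map_zero]
    exact zero_mem _
  have hnt : Nontrivial (Subrepresentation ρ) := by
    refine ⟨⊥, ⊤, fun h ↦ ?_⟩
    exact bot_ne_top (α := Submodule ℂ V) (congrArg Subrepresentation.toSubmodule h)
  obtain ⟨σ, hσ₀, hσ₁⟩ : ∃ σ : Subrepresentation ρ, σ ≠ ⊥ ∧ σ ≠ ⊤ := by
    by_contra! h
    exact hirr ⟨fun σ ↦ or_iff_not_imp_left.2 (h σ)⟩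
  have hss : ρ.IsSemisimpleRepresentation := inferInstance
  obtain ⟨τ, hστ⟩ := exists_isCompl σ
  have hc : IsCompl σ.toSubmodule τ.toSubmodule := by
    refine ⟨disjoint_iff.2 ?_, codisjoint_iff.2 ?_⟩
    · rw [← Subrepresentation.toSubmodule_inf, hστ.inf_eq_bot]; rfl
    · rw [← Subrepresentation.toSubmodule_sup, hστ.sup_eq_top]; rfl
  have hσ : σ.toSubmodule ≠ ⊥ := fun h ↦ hσ₀ (Subrepresentation.toSubmodule_injective h)
  have hσ' : σ.toSubmodule ≠ ⊤ := fun h ↦ hσ₁ (Subrepresentation.toSubmodule_injective h)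
  have hτ : τ.toSubmodule ≠ ⊤ := by
    intro h
    rw [h] at hc
    exact hσ (by simpa using hc.inf_eq_bot)
  rw [Representation.character, trace_eq_add_of_isCompl hc (f := ρ g)
    (fun _ hv ↦ σ.apply_mem_toSubmodule g hv) (fun _ hv ↦ τ.apply_mem_toSubmodule g hv)]
  exact add_mem
    (ih _ (hn ▸ Submodule.finrank_lt hσ') σ.toSubmodule σ.toRepresentation rfl)
    (ih _ (hn ▸ Submodule.finrank_lt hτ) τ.toSubmodule τ.toRepresentation rfl)

lemma charFieldAt_le {d : ℕ} {K : IntermediateField ℚ ℂ}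
    (h : ∀ (V : FDRep ℂ G) (g : G), orderOf g = d → V.character g ∈ K) : charFieldAt G d ≤ K := by
  refine IntermediateField.adjoin_le_iff.2 ?_
  rintro _ ⟨V, -, g, hg, rfl⟩
  exact h V g hg

lemma FDRep.character_eq_of_isConj (V : FDRep ℂ G) {g h : G} (hgh : IsConj g h) :
    V.character g = V.character h := by
  obtain ⟨c, rfl⟩ := isConj_iff.1 hgh
  exact (V.char_conj g c).symm

lemma FDRep.trace_aeval_mem (V : FDRep ℂ G) {g : G} {d : ℕ} (hg : g ^ d = 1)
    {K : IntermediateField ℚ ℂ} {f : Polynomial ℂ} (hf : ∀ z : ℂ, z ^ d = 1 → f.eval z ∈ K) :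
    LinearMap.trace ℂ V (Polynomial.aeval (V.ρ g) f) ∈ K :=
  _root_.trace_aeval_mem (by rw [← map_pow, hg, map_one]) hf

end CharacterFields

section Induction

variable {G : Type} [Group G]

/-- The representation of `G` on functions on `G` by right translation. -/
def rightTranslation (G : Type) [Group G] : Representation ℂ G (G → ℂ) where
  toFun a := LinearMap.funLeft ℂ ℂ (· * a)
  map_one' := by ext; simp
  map_mul' a b := by ext; simp [LinearMap.funLeft, mul_assoc]

lemma rightTranslation_apply (a : G) (f : G → ℂ) (x : G) : rightTranslation G a f x = f (x * a) :=
  rfl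

/-- The representation of `G` induced from the character of `⟨g⟩` sending `g` to `z`. -/
def inducedFromZPowers (g : G) (z : ℂ) : Subrepresentation (rightTranslation G) where
  toSubmodule :=
    { carrier := {f | ∀ x, f (g * x) = z * f x}
      add_mem' := fun hf hf' x ↦ by simp [hf x, hf' x, mul_add]
      zero_mem' := fun x ↦ by simp
      smul_mem' := fun c f hf x ↦ by simp [hf x, mul_left_comm] }
  apply_mem_toSubmodule a f hf x := by
    rw [rightTranslation_apply, rightTranslation_apply, mul_assoc]
    exact hf (x * a)

lemma mem_inducedFromZPowers {g : G} {z : ℂ} {f : G → ℂ} :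
    f ∈ (inducedFromZPowers g z).toSubmodule ↔ ∀ x, f (g * x) = z * f x := Iff.rfl

lemma apply_pow_mul_of_mem {g : G} {z : ℂ} {f : G → ℂ}
    (hf : f ∈ (inducedFromZPowers g z).toSubmodule) (j : ℕ) (x : G) :
    f (g ^ j * x) = z ^ j * f x := by
  induction j with
  | zero => simp
  | succ j ih => rw [pow_succ', mul_assoc, mem_inducedFromZPowers.1 hf, ih, pow_succ', mul_assoc]

/-- The character of `inducedFromZPowers g z` at `a⁻¹`. -/
lemma character_inducedFromZPowers [Fintype G] [DecidableEq G] {g : G} {d : ℕ} {z : ℂ}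
    (hg : g ^ d = 1) (hz : z ^ d = 1) (hz₀ : z ≠ 0) (a : G) :
    (d : ℂ) * (inducedFromZPowers g z).toRepresentation.character a⁻¹ =
      ∑ j ∈ Finset.range d, (z ^ j)⁻¹ *
        ((Finset.univ.filter fun x : G ↦ x * a * x⁻¹ = g ^ j).card : ℂ) := by
  set W := inducedFromZPowers g z
  set Q : (G → ℂ) →ₗ[ℂ] G → ℂ :=
    ∑ j ∈ Finset.range d, (z ^ j)⁻¹ • LinearMap.funLeft ℂ ℂ fun x ↦ g ^ j * (x * a⁻¹) with hQdef
  have hQ (f : G → ℂ) (x : G) :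
      Q f x = ∑ j ∈ Finset.range d, (z ^ j)⁻¹ * f (g ^ j * (x * a⁻¹)) := by
    simp [hQdef, LinearMap.sum_apply, LinearMap.funLeft]
  have hQW (f : G → ℂ) : Q f ∈ W.toSubmodule := by
    rw [mem_inducedFromZPowers]
    intro x
    have hstep (j : ℕ) : (z ^ j)⁻¹ * f (g ^ j * (g * x * a⁻¹)) =
        z * ((z ^ (j + 1))⁻¹ * f (g ^ (j + 1) * (x * a⁻¹))) := by
      rw [pow_succ, pow_succ]
      simp only [mul_assoc]
      field_simp
    rw [hQ, hQ, Finset.sum_congr rfl fun j _ ↦ hstep j, ← Finset.mul_sum]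
    congr 1
    have h₁ := Finset.sum_range_succ' (fun j ↦ (z ^ j)⁻¹ * f (g ^ j * (x * a⁻¹))) d
    rw [Finset.sum_range_succ, hg, hz, pow_zero, pow_zero] at h₁
    exact (add_right_cancel h₁).symm
  have hQres : Q.restrict (fun x _ ↦ hQW x : ∀ x ∈ W.toSubmodule, Q x ∈ W.toSubmodule) =
      (d : ℂ) • W.toRepresentation a⁻¹ := by
    ext ⟨f, hf⟩ x
    change Q f x = d * f (x * a⁻¹)
    rw [hQ, Finset.sum_congr rfl (g := fun _ ↦ f (x * a⁻¹))]
    · simp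
    · intro j _
      rw [apply_pow_mul_of_mem hf, inv_mul_cancel_left₀ (pow_ne_zero _ hz₀)]
  have htr := LinearMap.trace_restrict_eq_of_forall_mem W.toSubmodule Q hQW
  rw [hQres, map_smul, smul_eq_mul] at htr
  rw [Representation.character, htr, trace_pi_eq_sum]
  simp_rw [hQ]
  rw [Finset.sum_comm]
  refine Finset.sum_congr rfl fun j _ ↦ ?_
  rw [← Finset.mul_sum, Finset.card_filter, Nat.cast_sum]
  congr 1
  refine Finset.sum_congr rfl fun x _ ↦ ?_
  rw [Pi.single_apply, Nat.cast_ite, Nat.cast_one, Nat.cast_zero]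
  refine if_congr ?_ rfl rfl
  rw [mul_inv_eq_iff_eq_mul, ← mul_assoc, mul_inv_eq_iff_eq_mul, eq_comm]

/-- If the only powers of `g` conjugate to `g` are `g` and `g⁻¹`, then `charFieldAt` contains
`z + z⁻¹` for every root of unity `z` of order dividing that of `g`. -/
lemma add_inv_mem_charFieldAt [Finite G] {g : G} {d : ℕ} (hd : 2 < d) (hg : orderOf g = d)
    (hinv : IsConj g g⁻¹) (hpow : ∀ j < d, IsConj g (g ^ j) → j = 1 ∨ j = d - 1)
    {z : ℂ} (hz : z ^ d = 1) : z + z⁻¹ ∈ charFieldAt G d := by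
  classical
  cases nonempty_fintype G
  have hz₀ : z ≠ 0 := by rintro rfl; simp [show d ≠ 0 by omega] at hz
  have hgd : g ^ d = 1 := hg ▸ pow_orderOf_eq_one g
  have hgd' : g ^ (d - 1) = g⁻¹ := by
    rw [eq_inv_iff_mul_eq_one, ← pow_succ, Nat.sub_add_cancel (by omega), hgd]
  have hzd' : (z ^ (d - 1))⁻¹ = z := by
    rw [inv_eq_iff_eq_inv]
    refine eq_inv_of_mul_eq_one_left ?_
    rw [← pow_succ, Nat.sub_add_cancel (by omega), hz]
  have key := character_inducedFromZPowers hgd hz hz₀ g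
  have hmem := character_mem_charFieldAt (g := g⁻¹) (by rw [orderOf_inv, hg]) _
    (inducedFromZPowers g z).toRepresentation
  set N := fun j ↦ (Finset.univ.filter fun x : G ↦ x * g * x⁻¹ = g ^ j).card with hN
  have hN₀ : N 1 ≠ 0 := Finset.card_ne_zero.2 ⟨1, by simp⟩
  have hN₁ : N (d - 1) = N 1 := by
    obtain ⟨c, hc⟩ := isConj_iff.1 hinv
    refine Finset.card_equiv (Equiv.mulLeft c) fun x ↦ ?_
    have hc' : c * g⁻¹ * c⁻¹ = g := by rw [← conj_inv, hc, inv_inv]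
    have hx : c * x * g * (c * x)⁻¹ = c * (x * g * x⁻¹) * c⁻¹ := by group
    simp only [Finset.mem_filter, Finset.mem_univ, true_and, hgd', pow_one, Equiv.coe_mulLeft, hx]
    exact ⟨fun h ↦ by rw [h, hc'], fun h ↦ mul_left_cancel (mul_right_cancel (h.trans hc'.symm))⟩
  rw [Finset.sum_eq_add_of_mem 1 (d - 1) (Finset.mem_range.2 (by omega))
    (Finset.mem_range.2 (by omega)) (by omega)] at key
  · change _ = (z ^ 1)⁻¹ * (N 1 : ℂ) + (z ^ (d - 1))⁻¹ * (N (d - 1) : ℂ) at key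
    rw [hN₁, hzd', pow_one, ← add_mul, add_comm, ← div_eq_iff (Nat.cast_ne_zero.2 hN₀)] at key
    rw [← key]
    exact div_mem (mul_mem (natCast_mem _ _) hmem) (natCast_mem _ _)
  · intro j hj hj'
    have hempty : (Finset.univ.filter fun x : G ↦ x * g * x⁻¹ = g ^ j) = ∅ := by
      refine Finset.filter_eq_empty_iff.2 fun x _ hx ↦ ?_
      have := hpow j (Finset.mem_range.1 hj) (isConj_iff.2 ⟨x, hx⟩)
      tauto
    rw [hempty, Finset.card_empty, Nat.cast_zero, mul_zero]

end Induction

section TwoByTwo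

variable {F : Type} [Field F]

open Matrix

/-- A non-scalar `2 × 2` matrix is similar to the companion matrix of its characteristic
polynomial. -/
lemma exists_mul_eq_mul_companion {A : Matrix (Fin 2) (Fin 2) F}
    (hA : ∀ c : F, A ≠ scalar (Fin 2) c) :
    ∃ P : Matrix (Fin 2) (Fin 2) F, IsUnit P.det ∧ A * P = P * !![0, -A.det; 1, A.trace] := by
  by_cases h₁ : A 1 0 = 0
  · by_cases h₂ : A 0 1 = 0
    · refine ⟨!![1, A 0 0; 1, A 1 1], ?_, ?_⟩
      · rw [isUnit_iff_ne_zero, det_fin_two_of]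
        intro h
        refine hA (A 0 0) ?_
        ext i j
        fin_cases i <;> fin_cases j <;> simp [h₁, h₂]
        linear_combination h
      · ext i j
        fin_cases i <;> fin_cases j <;>
          simp [mul_apply, det_fin_two, trace_fin_two, h₁, h₂] <;> ring
    · refine ⟨!![0, A 0 1; 1, A 1 1], by simpa [det_fin_two_of] using h₂, ?_⟩
      ext i j
      fin_cases i <;> fin_cases j <;> simp [mul_apply, det_fin_two, trace_fin_two, h₁] <;> ring
  · refine ⟨!![1, A 0 0; 0, A 1 0], by simpa [det_fin_two_of] using h₁, ?_⟩
    ext i j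
    fin_cases i <;> fin_cases j <;> simp [mul_apply, det_fin_two, trace_fin_two] <;> ring

lemma isConj_of_trace_eq_of_det_eq {g h : GL (Fin 2) F} (hg : ∀ c : F, g.1 ≠ scalar (Fin 2) c)
    (hh : ∀ c : F, h.1 ≠ scalar (Fin 2) c) (htr : g.1.trace = h.1.trace)
    (hdet : g.1.det = h.1.det) : IsConj g h := by
  obtain ⟨P, hP, hgP⟩ := exists_mul_eq_mul_companion hg
  obtain ⟨Q, hQ, hhQ⟩ := exists_mul_eq_mul_companion hh
  rw [htr, hdet] at hgP
  set C : Matrix (Fin 2) (Fin 2) F := !![0, -h.1.det; 1, h.1.trace]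
  rw [← isUnit_iff_isUnit_det] at hP hQ
  obtain ⟨P, rfl⟩ := hP
  obtain ⟨Q, rfl⟩ := hQ
  rw [isConj_iff]
  refine ⟨Q * P⁻¹, ?_⟩
  ext1
  have hC : C = (P⁻¹).1 * (g.1 * P.1) := by rw [hgP, ← mul_assoc]; simp
  rw [hC] at hhQ
  have : h.1 = h.1 * Q.1 * (Q⁻¹).1 := by rw [mul_assoc]; simp
  rw [this, hhQ]
  simp [mul_assoc]

lemma isConj_trace_eq {g h : GL (Fin 2) F} (hgh : IsConj g h) : g.1.trace = h.1.trace := by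
  obtain ⟨c, rfl⟩ := isConj_iff.1 hgh
  rw [Units.val_mul, Units.val_mul, trace_mul_comm, ← mul_assoc]
  simp

lemma sub_one_sq_eq_zero {A : Matrix (Fin 2) (Fin 2) F} (htr : A.trace = 2) (hdet : A.det = 1) :
    (A - 1) ^ 2 = 0 := by
  rw [trace_fin_two] at htr
  rw [det_fin_two] at hdet
  have h : A 1 1 = 2 - A 0 0 := by linear_combination htr
  rw [h] at hdet
  ext i j
  fin_cases i <;> fin_cases j <;> simp [pow_two, mul_apply, h]
  · linear_combination -hdet
  · ring
  · ring
  · linear_combination -hdet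

lemma add_inv_eq_scalar {g : GL (Fin 2) F} (hdet : g.1.det = 1) :
    g.1 + (g⁻¹).1 = scalar (Fin 2) g.1.trace := by
  rw [coe_units_inv, inv_def, hdet, adjugate_fin_two]
  ext i j
  fin_cases i <;> fin_cases j <;> simp [trace_fin_two, add_comm]

lemma trace_inv_eq {g : GL (Fin 2) F} (hdet : g.1.det = 1) : (g⁻¹).1.trace = g.1.trace := by
  rw [coe_units_inv, inv_def, hdet, adjugate_fin_two]
  simp [trace_fin_two, add_comm]

lemma pow_char_eq_one {p : ℕ} [Fact p.Prime] [CharP F p] {g : GL (Fin 2) F}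
    (htr : g.1.trace = 2) (hdet : g.1.det = 1) : g ^ p = 1 := by
  have hp := (Fact.out : p.Prime).two_le
  ext1
  rw [Units.val_pow_eq_pow_val, Units.val_one, ← sub_eq_zero]
  have h := sub_pow_char_of_commute (p := p) (Commute.one_right g.1)
  rw [one_pow] at h
  rw [← h, ← Nat.sub_add_cancel hp, pow_add, sub_one_sq_eq_zero htr hdet, mul_zero]

lemma trace_eq_two_and_det_eq_one {p : ℕ} [Fact p.Prime] [CharP F p] {g : GL (Fin 2) F} {m : ℕ}
    (hg : g ^ p ^ m = 1) : g.1.trace = 2 ∧ g.1.det = 1 := by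
  have hg' : g.1 ^ p ^ m = 1 := by rw [← Units.val_pow_eq_pow_val, hg, Units.val_one]
  constructor
  · have h := sub_pow_char_pow_of_commute (p := p) (n := m) (Commute.one_right g.1)
    rw [hg', one_pow, sub_self] at h
    have := (isNilpotent_trace_of_isNilpotent ⟨_, h⟩).eq_zero
    rw [trace_sub, trace_one, sub_eq_zero] at this
    simpa using this
  · have h := congrArg det hg'
    rw [det_pow, det_one] at h
    have hpm : p ^ m ≠ 0 := pow_ne_zero _ (Fact.out : p.Prime).ne_zero
    refine sub_eq_zero.1 ((pow_eq_zero_iff hpm).1 ?_)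
    rw [sub_pow_char_pow, h, one_pow, sub_self]

lemma eq_one_of_det_sub_one_eq_zero {p : ℕ} [Fact p.Prime] [CharP F p] {g : GL (Fin 2) F} {d : ℕ}
    (hd : d.Coprime p) (hg : g ^ d = 1) (hdet : g.1.det = 1) (h : (g.1 - 1).det = 0) : g = 1 := by
  have htr : g.1.trace = 2 := by
    rw [det_fin_two] at h hdet
    rw [trace_fin_two]
    simp at h
    linear_combination hdet - h
  have := pow_gcd_eq_one.2 ⟨hg, pow_char_eq_one (p := p) htr hdet⟩
  rwa [hd.gcd_eq_one, pow_one] at this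

lemma pow_eq_one_or_pow_eq_one_of_isConj {p : ℕ} [Fact p.Prime] [CharP F p] {g : GL (Fin 2) F}
    {d : ℕ} (hd : d.Coprime p) (hg : g ^ d = 1) (hdet : g.1.det = 1) {j : ℕ}
    (hj : IsConj g (g ^ (j + 1))) : g ^ j = 1 ∨ g ^ (j + 2) = 1 := by
  have hdetpow (k : ℕ) : (g ^ k).1.det = 1 := by
    rw [Units.val_pow_eq_pow_val, det_pow, hdet, one_pow]
  have hpow (k : ℕ) : (g ^ k) ^ d = 1 := by rw [← pow_mul, mul_comm, pow_mul, hg, one_pow]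
  have hsum : g.1 + (g⁻¹).1 = (g ^ (j + 1)).1 + ((g ^ (j + 1))⁻¹).1 := by
    rw [add_inv_eq_scalar hdet, add_inv_eq_scalar (hdetpow _), isConj_trace_eq hj]
  have hprod : ((g ^ j).1 - 1) * ((g ^ (j + 2)).1 - 1) = 0 := by
    have h := congrArg ((g ^ (j + 1)).1 * ·) hsum
    simp only [mul_add, ← Units.val_mul] at h
    rw [← pow_succ, pow_succ g j, mul_inv_cancel_right, ← pow_succ, mul_inv_cancel] at h
    rw [sub_mul, mul_sub, ← Units.val_mul, ← pow_add, mul_one, one_mul,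
      show j + (j + 2) = (j + 1) + (j + 1) by ring, pow_add]
    rw [show j + 1 + 1 = j + 2 from rfl, Units.val_one] at h
    have hcomb : ∀ a b c : Matrix (Fin 2) (Fin 2) F, a - b - (c - 1) = a + 1 - (c + b) := by
      intros; abel
    rw [hcomb, h, sub_self]
  rcases mul_eq_zero.1 (by rw [← det_mul, hprod, det_zero] :
    ((g ^ j).1 - 1).det * ((g ^ (j + 2)).1 - 1).det = 0) with h | h
  · exact .inl (eq_one_of_det_sub_one_eq_zero hd (hpow _) (hdetpow _) h)
  · exact .inr (eq_one_of_det_sub_one_eq_zero hd (hpow _) (hdetpow _) h)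

end TwoByTwo

section RootsOfUnity

lemma isPrimitiveRoot_zeta {d : ℕ} (hd : d ≠ 0) : IsPrimitiveRoot (zeta d) d :=
  Complex.isPrimitiveRoot_exp d hd

lemma mem_adjoin_zeta_of_pow_eq_one {d : ℕ} (hd : d ≠ 0) {z : ℂ} (hz : z ^ d = 1) :
    z ∈ IntermediateField.adjoin ℚ {zeta d} := by
  have : NeZero d := ⟨hd⟩
  obtain ⟨i, -, rfl⟩ := (isPrimitiveRoot_zeta hd).eq_pow_of_pow_eq_one hz
  exact pow_mem (IntermediateField.mem_adjoin_simple_self ℚ _) i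

lemma pow_add_inv_pow_mem {K : IntermediateField ℚ ℂ} {w : ℂ} (hw : w ≠ 0) (h : w + w⁻¹ ∈ K)
    (k : ℕ) : w ^ k + (w ^ k)⁻¹ ∈ K := by
  induction k using Nat.twoStepInduction with
  | zero => simpa using add_mem (one_mem K) (one_mem K)
  | one => simpa using h
  | more k ih₀ ih₁ =>
    have : w ^ (k + 2) + (w ^ (k + 2))⁻¹ =
        (w ^ (k + 1) + (w ^ (k + 1))⁻¹) * (w + w⁻¹) - (w ^ k + (w ^ k)⁻¹) := by
      field_simp
      ring
    rw [this]
    exact sub_mem (mul_mem ih₁ h) ih₀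

lemma add_inv_mem_adjoin_zeta_add_inv {d : ℕ} (hd : d ≠ 0) {z : ℂ} (hz : z ^ d = 1) :
    z + z⁻¹ ∈ IntermediateField.adjoin ℚ {zeta d + (zeta d)⁻¹} := by
  have : NeZero d := ⟨hd⟩
  obtain ⟨i, -, rfl⟩ := (isPrimitiveRoot_zeta hd).eq_pow_of_pow_eq_one hz
  exact pow_add_inv_pow_mem ((isPrimitiveRoot_zeta hd).ne_zero hd)
    (IntermediateField.mem_adjoin_simple_self ℚ _) i

end RootsOfUnity

section Cases

variable {G : Type} [Group G]

lemma charFieldAt_le_adjoin_zeta {d : ℕ} (hd : d ≠ 0) :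
    charFieldAt G d ≤ IntermediateField.adjoin ℚ {zeta d} := by
  refine charFieldAt_le fun V g hg ↦ ?_
  have := V.trace_aeval_mem (K := IntermediateField.adjoin ℚ {zeta d}) (f := Polynomial.X)
    (hg ▸ pow_orderOf_eq_one g) fun z hz ↦ by
      simpa using mem_adjoin_zeta_of_pow_eq_one hd hz
  rwa [Polynomial.aeval_X] at this

lemma charFieldAt_le_adjoin_zeta_add_inv {d : ℕ} (hd : d ≠ 0)
    (hinv : ∀ g : G, orderOf g = d → IsConj g g⁻¹) :
    charFieldAt G d ≤ IntermediateField.adjoin ℚ {zeta d + (zeta d)⁻¹} := by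
  refine charFieldAt_le fun V g hg ↦ ?_
  have hpow : g ^ (d - 1) = g⁻¹ := by
    rw [eq_inv_iff_mul_eq_one, ← pow_succ, Nat.sub_add_cancel (by omega), ← hg, pow_orderOf_eq_one]
  have := V.trace_aeval_mem (K := IntermediateField.adjoin ℚ {zeta d + (zeta d)⁻¹})
    (f := Polynomial.X + Polynomial.X ^ (d - 1)) (hg ▸ pow_orderOf_eq_one g) fun z hz ↦ by
      have hz' : z ^ (d - 1) = z⁻¹ := by
        refine eq_inv_of_mul_eq_one_left ?_
        rw [← pow_succ, Nat.sub_add_cancel (by omega), hz]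
      simpa [hz'] using add_inv_mem_adjoin_zeta_add_inv hd hz
  rw [map_add, map_pow, Polynomial.aeval_X, ← map_pow, hpow, map_add] at this
  change V.character g + V.character g⁻¹ ∈ _ at this
  rw [← V.character_eq_of_isConj (hinv g hg), ← two_mul] at this
  have h2 := div_mem this (ofNat_mem (IntermediateField.adjoin ℚ {zeta d + (zeta d)⁻¹}) 2)
  rwa [mul_div_cancel_left₀ _ two_ne_zero] at h2

lemma charFieldAt_prime_eq_bot {p : ℕ} (hp : p.Prime)
    (hconj : ∀ g : G, orderOf g = p → ∀ k, 0 < k → k < p → IsConj g (g ^ k)) :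
    charFieldAt G p = ⊥ := by
  refine le_bot_iff.1 (charFieldAt_le fun V g hg ↦ ?_)
  have := V.trace_aeval_mem (K := ⊥) (f := ∑ k ∈ Finset.range p, Polynomial.X ^ k)
    (hg ▸ pow_orderOf_eq_one g) fun z hz ↦ by
      rw [Polynomial.eval_finsetSum]
      simp only [Polynomial.eval_pow, Polynomial.eval_X]
      by_cases h1 : z = 1
      · simp [h1]
      · rw [geom_sum_eq h1, hz, sub_self, zero_div]
        exact zero_mem _
  obtain ⟨m, rfl⟩ : ∃ m, p = m + 1 := ⟨p - 1, (Nat.sub_add_cancel hp.one_le).symm⟩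
  have hm : (m : ℂ) ≠ 0 := Nat.cast_ne_zero.2 (by have := hp.two_le; omega)
  simp only [map_sum, map_pow, Polynomial.aeval_X] at this
  simp only [← map_pow] at this
  change ∑ k ∈ Finset.range (m + 1), V.character (g ^ k) ∈ _ at this
  rw [Finset.sum_range_succ', pow_zero, V.char_one,
    Finset.sum_congr rfl (g := fun _ ↦ V.character g) fun k hk ↦
      (V.character_eq_of_isConj (hconj g hg (k + 1) k.succ_pos
        (Nat.succ_lt_succ (Finset.mem_range.1 hk)))).symm, Finset.sum_const, Finset.card_range,
    nsmul_eq_mul] at this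
  have h := div_mem (sub_mem this (natCast_mem ⊥ (Module.finrank ℂ V)))
    (natCast_mem (⊥ : IntermediateField ℚ ℂ) m)
  rwa [add_sub_cancel_right, mul_div_cancel_left₀ _ hm] at h

end Cases

section GeneralLinear

open Matrix

variable {F : Type} [Field F]

lemma zeta_mem_charFieldAt_GL [Fintype F] {ℓ r : ℕ} (hℓ : ℓ.Prime) (hr : 1 ≤ r)
    (hdvd : ℓ ^ r ∣ Fintype.card F - 1) : zeta (ℓ ^ r) ∈ charFieldAt (GL (Fin 2) F) (ℓ ^ r) := by
  classical
  obtain ⟨m, rfl⟩ : ∃ m, r = m + 1 := ⟨r - 1, by omega⟩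
  have : Fact ℓ.Prime := ⟨hℓ⟩
  have : NeZero (ℓ ^ (m + 1)) := ⟨pow_ne_zero _ hℓ.ne_zero⟩
  obtain ⟨w, hw⟩ : ∃ w : Fˣ, orderOf w = ℓ ^ (m + 1) := by
    obtain ⟨u, hu⟩ := IsCyclic.exists_generator (α := Fˣ)
    have hcard : orderOf u = Fintype.card F - 1 := by
      rw [orderOf_eq_card_of_forall_mem_zpowers hu, Nat.card_eq_fintype_card, Fintype.card_units]
    obtain ⟨c, hc⟩ := hdvd
    refine ⟨u ^ c, ?_⟩
    have hpos := hcard ▸ orderOf_pos u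
    have hc0 : c ≠ 0 := by rintro rfl; simp [hc] at hpos
    rw [orderOf_pow_of_dvd hc0 (by rw [hcard, hc]; exact dvd_mul_left _ _), hcard, hc]
    exact Nat.mul_div_cancel _ (Nat.pos_of_ne_zero hc0)
  have hwm : w ^ ℓ ^ m ≠ 1 := by
    intro h
    have := Nat.le_of_dvd (pow_pos hℓ.pos _) (hw ▸ orderOf_dvd_of_pow_eq_one h)
    exact (Nat.pow_lt_pow_succ hℓ.one_lt).not_ge this
  have : NeZero (Monoid.exponent Fˣ : ℂ) :=
    ⟨Nat.cast_ne_zero.2 (Monoid.exponent_ne_zero_of_finite)⟩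
  obtain ⟨ψ, hψ⟩ := CommGroup.exists_apply_ne_one_of_hasEnoughRootsOfUnity Fˣ ℂ hwm
  rw [map_pow] at hψ
  have hord : orderOf (ψ w) = ℓ ^ (m + 1) :=
    orderOf_eq_prime_pow hψ (by rw [← map_pow, ← hw, pow_orderOf_eq_one, map_one])
  let ρ : Representation ℂ (GL (Fin 2) F) ℂ :=
    (Algebra.lmul ℂ ℂ : ℂ →* Module.End ℂ ℂ).comp
      ((Units.coeHom ℂ).comp (ψ.comp Matrix.GeneralLinearGroup.det))
  let D : Fˣ →* GL (Fin 2) F := Units.map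
    { toFun := fun u ↦ Matrix.diagonal ![u, 1]
      map_one' := by ext i j; fin_cases i <;> fin_cases j <;> simp
      map_mul' := fun u v ↦ by ext i j; fin_cases i <;> fin_cases j <;> simp }
  have hDval (u : Fˣ) : (D u).1 = Matrix.diagonal ![(u : F), 1] := rfl
  have hD : Function.Injective D := fun u v huv ↦ by
    have : (D u).1 0 0 = (D v).1 0 0 := by rw [huv]
    rw [hDval, hDval] at this
    exact Units.ext (by simpa using this)
  have hdet : Matrix.GeneralLinearGroup.det (D w) = w := by
    ext
    rw [Matrix.GeneralLinearGroup.val_det_apply, hDval, Matrix.det_diagonal]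
    simp
  have hmem := character_mem_charFieldAt (d := ℓ ^ (m + 1)) (g := D w)
    (by rw [orderOf_injective D hD, hw]) ℂ ρ
  have hchar : ρ.character (D w) = (ψ w : ℂ) := by
    have hρ : ρ (D w) = (ψ w : ℂ) • LinearMap.id := by
      ext
      simp [ρ, hdet]
    rw [Representation.character, hρ, map_smul, LinearMap.trace_id, Module.finrank_self]
    simp
  rw [hchar] at hmem
  have hprim : IsPrimitiveRoot (ψ w : ℂ) (ℓ ^ (m + 1)) := by
    rw [← hord, ← orderOf_units]
    exact IsPrimitiveRoot.orderOf _
  obtain ⟨i, -, hi⟩ := hprim.eq_pow_of_pow_eq_one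
    (isPrimitiveRoot_zeta (pow_ne_zero (m + 1) hℓ.ne_zero)).pow_eq_one
  rw [← hi]
  exact pow_mem hmem i

lemma det_eq_one_of_dvd_card_add_one [Fintype F] {d : ℕ} (hd : Odd d)
    (hdvd : d ∣ Fintype.card F + 1) {g : GL (Fin 2) F} (hg : g ^ d = 1) : g.1.det = 1 := by
  have hu : g.1.det ^ d = 1 := by
    rw [← det_pow, ← Units.val_pow_eq_pow_val, hg, Units.val_one, det_one]
  have hu₂ : g.1.det ^ 2 = 1 := by
    obtain ⟨c, hc⟩ := hdvd
    have h : g.1.det ^ (Fintype.card F + 1) = 1 := by rw [hc, pow_mul, hu, one_pow]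
    rwa [pow_succ, FiniteField.pow_card, ← pow_two] at h
  have := pow_gcd_eq_one.2 ⟨hu, hu₂⟩
  rwa [Nat.Coprime.gcd_eq_one (Nat.coprime_two_right.2 hd), pow_one] at this

lemma ne_scalar_of_pow_eq_one {d : ℕ} (hd : Odd d) {g : GL (Fin 2) F} (hg : g ^ d = 1)
    (hdet : g.1.det = 1) (hg₁ : g ≠ 1) (c : F) : g.1 ≠ scalar (Fin 2) c := by
  intro h
  have h₂ : c ^ 2 = 1 := by simpa [h] using hdet
  have hd' : c ^ d = 1 := by
    have := congrArg Units.val hg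
    rw [Units.val_pow_eq_pow_val, h, ← map_pow] at this
    simpa using congrFun (congrFun this 0) 0
  have := pow_gcd_eq_one.2 ⟨hd', h₂⟩
  rw [Nat.Coprime.gcd_eq_one (Nat.coprime_two_right.2 hd), pow_one] at this
  refine hg₁ (Units.ext ?_)
  rw [h, this, map_one, Units.val_one]

lemma isConj_inv_of_odd {d : ℕ} (hd : Odd d) {g : GL (Fin 2) F} (hg : g ^ d = 1)
    (hdet : g.1.det = 1) : IsConj g g⁻¹ := by
  by_cases hg₁ : g = 1
  · rw [hg₁, inv_one]
  have hdet' : (g⁻¹).1.det = 1 := by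
    have : g.1.det * (g⁻¹).1.det = 1 := by rw [← det_mul]; simp
    rwa [hdet, one_mul] at this
  exact isConj_of_trace_eq_of_det_eq (ne_scalar_of_pow_eq_one hd hg hdet hg₁)
    (ne_scalar_of_pow_eq_one hd (by rw [inv_pow, hg, inv_one]) hdet' (inv_ne_one.2 hg₁))
    (trace_inv_eq hdet).symm (hdet.trans hdet'.symm)

lemma isConj_pow_of_orderOf_eq_char {p : ℕ} [Fact p.Prime] [CharP F p] (hodd : Odd p)
    {g : GL (Fin 2) F} (hg : orderOf g = p) {k : ℕ} (hk : 0 < k) (hkp : k < p) :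
    IsConj g (g ^ k) := by
  have hgp : g ^ p = 1 := hg ▸ pow_orderOf_eq_one g
  have hgk : (g ^ k) ^ p = 1 := by rw [← pow_mul, mul_comm, pow_mul, hgp, one_pow]
  obtain ⟨ht, hd⟩ := trace_eq_two_and_det_eq_one (p := p) (m := 1) (g := g) (by rwa [pow_one])
  obtain ⟨htk, hdk⟩ := trace_eq_two_and_det_eq_one (p := p) (m := 1) (g := g ^ k) (by rwa [pow_one])
  refine isConj_of_trace_eq_of_det_eq
    (ne_scalar_of_pow_eq_one hodd hgp hd fun h ↦ ?_)
    (ne_scalar_of_pow_eq_one hodd hgk hdk fun h ↦ ?_) (ht.trans htk.symm) (hd.trans hdk.symm)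
  · rw [h, orderOf_one] at hg
    exact (Fact.out : p.Prime).ne_one hg.symm
  · exact Nat.not_dvd_of_pos_of_lt hk hkp (hg ▸ orderOf_dvd_of_pow_eq_one h)

end GeneralLinear

/-- If `ℓ` is an odd prime and `GL_2(F_q)` contains an element of order
`ℓ^r`, then `K_{ℓ^r}(GL_2(F_q))` equals `ℚ(ζ_{ℓ^r})` if `q ≡ 1 (mod ℓ^r)`,
`ℚ(ζ_{ℓ^r} + ζ_{ℓ^r}^{−1})` if `q ≡ −1 (mod ℓ^r)`, and `ℚ` if `q ≡ 0 (mod ℓ^r)`. -/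
theorem statement13 (p n q ℓ r : ℕ) (hp : p.Prime) (hn : 1 ≤ n) (hq : q = p ^ n)
    (hℓ : ℓ.Prime) (hodd : Odd ℓ) (hr : 1 ≤ r)
    (F : Type) [Field F] [Fintype F] (hF : Fintype.card F = q)
    (hex : ∃ g : GL (Fin 2) F, orderOf g = ℓ ^ r) :
    ((q : ZMod (ℓ ^ r)) = 1 →
      charFieldAt (GL (Fin 2) F) (ℓ ^ r) = IntermediateField.adjoin ℚ {zeta (ℓ ^ r)}) ∧
    ((q : ZMod (ℓ ^ r)) = -1 →
      charFieldAt (GL (Fin 2) F) (ℓ ^ r) =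
        IntermediateField.adjoin ℚ {zeta (ℓ ^ r) + (zeta (ℓ ^ r))⁻¹}) ∧
    ((q : ZMod (ℓ ^ r)) = 0 →
      charFieldAt (GL (Fin 2) F) (ℓ ^ r) = ⊥) := by
  have : Fact p.Prime := ⟨hp⟩
  have : CharP F p := charP_of_card_eq_prime_pow (hF.trans hq)
  have hd₀ : ℓ ^ r ≠ 0 := pow_ne_zero _ hℓ.ne_zero
  have hdodd : Odd (ℓ ^ r) := hodd.pow
  have hd₂ : 2 < ℓ ^ r := by
    have h₂ : 2 < ℓ := lt_of_le_of_ne hℓ.two_le fun h ↦ by subst h; revert hodd; decide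
    exact h₂.trans_le (Nat.le_self_pow (by omega) ℓ)
  obtain ⟨g, hg⟩ := hex
  refine ⟨fun h ↦ ?_, fun h ↦ ?_, fun h ↦ ?_⟩
  · refine le_antisymm (charFieldAt_le_adjoin_zeta hd₀) ?_
    rw [IntermediateField.adjoin_simple_le_iff]
    refine zeta_mem_charFieldAt_GL hℓ hr ?_
    rw [← ZMod.natCast_eq_zero_iff, Nat.cast_sub Fintype.card_pos, hF, h, Nat.cast_one, sub_self]
  · have hdvd : ℓ ^ r ∣ Fintype.card F + 1 := by
      rw [← ZMod.natCast_eq_zero_iff, Nat.cast_add, hF, h, Nat.cast_one, neg_add_cancel]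
    have hcop : (ℓ ^ r).Coprime p := by
      refine Nat.Coprime.coprime_dvd_left hdvd (Nat.Coprime.coprime_dvd_right
        (hF ▸ hq ▸ dvd_pow_self p (by omega) : p ∣ Fintype.card F) ?_)
      simp
    have hinv (x : GL (Fin 2) F) (hx : orderOf x = ℓ ^ r) : IsConj x x⁻¹ := by
      have hx₁ : x ^ ℓ ^ r = 1 := hx ▸ pow_orderOf_eq_one x
      exact isConj_inv_of_odd hdodd hx₁ (det_eq_one_of_dvd_card_add_one hdodd hdvd hx₁)
    refine le_antisymm (charFieldAt_le_adjoin_zeta_add_inv hd₀ hinv) ?_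
    rw [IntermediateField.adjoin_simple_le_iff]
    refine add_inv_mem_charFieldAt hd₂ hg (hinv g hg) (fun j hj hconj ↦ ?_)
      (isPrimitiveRoot_zeta hd₀).pow_eq_one
    have hg₁ : g ^ ℓ ^ r = 1 := hg ▸ pow_orderOf_eq_one g
    obtain _ | j := j
    · rw [pow_zero, isConj_one_left] at hconj
      rw [hconj, orderOf_one] at hg
      omega
    rcases pow_eq_one_or_pow_eq_one_of_isConj hcop hg₁
      (det_eq_one_of_dvd_card_add_one hdodd hdvd hg₁) hconj with hj' | hj'
    · have := Nat.eq_zero_of_dvd_of_lt (hg ▸ orderOf_dvd_of_pow_eq_one hj') (by omega)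
      omega
    · have := Nat.le_of_dvd (by omega) (hg ▸ orderOf_dvd_of_pow_eq_one hj')
      omega
  · have hdvd : ℓ ^ r ∣ p ^ n := by rwa [ZMod.natCast_eq_zero_iff, hq] at h
    obtain rfl : ℓ = p := (Nat.prime_dvd_prime_iff_eq hℓ hp).1
      (hℓ.dvd_of_dvd_pow ((dvd_pow_self ℓ (by omega)).trans hdvd))
    obtain ⟨ht, hd⟩ := trace_eq_two_and_det_eq_one (p := ℓ) (hg ▸ pow_orderOf_eq_one g)
    have hle : ℓ ^ r ≤ ℓ ^ 1 := by
      rw [pow_one]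
      exact Nat.le_of_dvd hℓ.pos (hg ▸ orderOf_dvd_of_pow_eq_one (pow_char_eq_one ht hd))
    obtain rfl : r = 1 := le_antisymm ((Nat.pow_le_pow_iff_right hℓ.one_lt).1 hle) hr
    rw [pow_one]
    exact charFieldAt_prime_eq_bot hℓ fun x hx k hk hkℓ ↦
      isConj_pow_of_orderOf_eq_char hodd hx hk hkℓ
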